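/- arXiv:1805.11064 — 2 statements merged into one kernel-verified Lean document; each statement's English description precedes it below -/
import Mathlib

section
/- If λ < 2^{−4}·min{δℛ_i, 1/2} for some i ∈ {1,…,L}, then the support of every invariant probability measure μ on 𝕊^L (i.e. every μ with μ(A) = ∫_{𝕊^L} P(ℛ(1+λrU)·v ∈ A) dμ(v) for all Borel A) is a strict subset of 𝕊^L. -/
open MeasureTheory ProbabilityTheory Matrix Real
open scoped ENNReal

noncomputable section

abbrev Sph (L : ℕ) := Metric.sphere (0 : EuclideanSpace ℝ (Fin (L+1))) 1

/-- The projective action `T · v = T v / ‖T v‖` on vectors. -/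
noncomputable def act {n : ℕ} (T : Matrix (Fin n) (Fin n) ℝ)
    (v : EuclideanSpace ℝ (Fin n)) : EuclideanSpace ℝ (Fin n) :=
  ‖Matrix.toEuclideanLin T v‖⁻¹ • Matrix.toEuclideanLin T v

/-- The projective action on the unit sphere (junk value `v` if `T v = 0`). -/
noncomputable def actS {L : ℕ} (T : Matrix (Fin (L+1)) (Fin (L+1)) ℝ) (v : Sph L) : Sph L :=
  if h : ‖Matrix.toEuclideanLin T (v : EuclideanSpace ℝ (Fin (L+1)))‖ = 0 then v
  else ⟨act T v, by
    rw [mem_sphere_zero_iff_norm, act, norm_smul, norm_inv, norm_norm, inv_mul_cancel₀ h]⟩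

instance {m n α : Type*} [MeasurableSpace α] : MeasurableSpace (Matrix m n α) :=
  inferInstanceAs (MeasurableSpace (m → n → α))

/-- `U` is Haar distributed on the orthogonal group `O(L+1)`: it takes values in the
orthogonal group and its law is invariant under left translation (which characterizes
the Haar probability measure on this compact group). -/
def IsHaarOrth {L : ℕ} {Ω : Type*} [MeasurableSpace Ω] (P : Measure Ω)
    (U : Ω → Matrix (Fin (L+1)) (Fin (L+1)) ℝ) : Prop :=
  Measurable U ∧ (∀ ω, U ω ∈ Matrix.orthogonalGroup (Fin (L+1)) ℝ) ∧
    ∀ O ∈ Matrix.orthogonalGroup (Fin (L+1)) ℝ,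
      Measure.map (fun ω => O * U ω) P = Measure.map U P

/-- `ν` is the normalized rotation-invariant surface measure on the sphere: it is the unique
rotation-invariant Borel probability measure. -/
def IsUniformSphere {L : ℕ} (ν : Measure (Sph L)) : Prop :=
  IsProbabilityMeasure ν ∧
    ∀ O ∈ Matrix.orthogonalGroup (Fin (L+1)) ℝ, Measure.map (actS O) ν = ν

/-- Topological support of a measure. -/
def msupport {X : Type*} [TopologicalSpace X] [MeasurableSpace X] (μ : Measure X) : Set X :=
  {x | ∀ s : Set X, IsOpen s → x ∈ s → 0 < μ s}

/-- `‖𝔞(v)‖²`, the squared norm of the first `La` components. -/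
noncomputable def naSq {n : ℕ} (La : ℕ) (v : EuclideanSpace ℝ (Fin n)) : ℝ :=
  ∑ k : Fin n, if (k : ℕ) < La then (v k)^2 else 0

/-- `‖𝔠(v)‖²`, the squared norm of the components with index `> La + Lb`. -/
noncomputable def ncSq {n : ℕ} (Lab : ℕ) (v : EuclideanSpace ℝ (Fin n)) : ℝ :=
  ∑ k : Fin n, if Lab ≤ (k : ℕ) then (v k)^2 else 0

/-- Ordered application of the (random) matrices `M 0, …, M (N-1)` to `v`. -/
noncomputable def chainW {L : ℕ} {Ω : Type*}
    (M : ℕ → Ω → Matrix (Fin (L+1)) (Fin (L+1)) ℝ) :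
    ℕ → Ω → Sph L → Sph L
  | 0, _, v => v
  | (n+1), ω, v => actS (M n ω) (chainW M n ω v)

/-- Ordered application of the matrices `M 0, …, M (N-1)` to `v` (deterministic). -/
noncomputable def chainD {L : ℕ} (M : ℕ → Matrix (Fin (L+1)) (Fin (L+1)) ℝ) :
    ℕ → Sph L → Sph L
  | 0, v => v
  | (n+1), v => actS (M n) (chainD M n v)

section SplitNorms

variable {n : ℕ}

lemma naSq_add_ncSq (d : ℕ) (v : EuclideanSpace ℝ (Fin n)) :
    naSq d v + ncSq d v = ‖v‖ ^ 2 := by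
  rw [EuclideanSpace.real_norm_sq_eq, naSq, ncSq, ← Finset.sum_add_distrib]
  refine Finset.sum_congr rfl fun k _ => ?_
  by_cases h : (k : ℕ) < d
  · simp [h]
  · simp [h, not_lt.1 h]

lemma naSq_nonneg (d : ℕ) (v : EuclideanSpace ℝ (Fin n)) : 0 ≤ naSq d v :=
  Finset.sum_nonneg fun k _ => by split_ifs <;> positivity

lemma ncSq_nonneg (d : ℕ) (v : EuclideanSpace ℝ (Fin n)) : 0 ≤ ncSq d v :=
  Finset.sum_nonneg fun k _ => by split_ifs <;> positivity

lemma naSq_smul (d : ℕ) (c : ℝ) (v : EuclideanSpace ℝ (Fin n)) :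
    naSq d (c • v) = c ^ 2 * naSq d v := by
  simp only [naSq, Finset.mul_sum, PiLp.smul_apply, smul_eq_mul, mul_pow, mul_ite, mul_zero]

lemma ncSq_smul (d : ℕ) (c : ℝ) (v : EuclideanSpace ℝ (Fin n)) :
    ncSq d (c • v) = c ^ 2 * ncSq d v := by
  simp only [ncSq, Finset.mul_sum, PiLp.smul_apply, smul_eq_mul, mul_pow, mul_ite, mul_zero]

lemma continuous_naSq (d : ℕ) : Continuous (naSq d : EuclideanSpace ℝ (Fin n) → ℝ) :=
  continuous_finsetSum _ fun k _ => by split_ifs <;> fun_prop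

lemma continuous_ncSq (d : ℕ) : Continuous (ncSq d : EuclideanSpace ℝ (Fin n) → ℝ) :=
  continuous_finsetSum _ fun k _ => by split_ifs <;> fun_prop

lemma naSq_add_smul_le (d : ℕ) {s t : ℝ} (ht : 0 < t) (v u : EuclideanSpace ℝ (Fin n)) :
    naSq d (v + s • u) ≤ (1 + t) * naSq d v + (1 + 1 / t) * s ^ 2 * naSq d u := by
  simp only [naSq, Finset.mul_sum, ← Finset.sum_add_distrib]
  refine Finset.sum_le_sum fun k _ => ?_
  split_ifs
  · simp only [PiLp.add_apply, PiLp.smul_apply, smul_eq_mul]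
    have h : 0 ≤ (t * v k - s * u k) ^ 2 / t := by positivity
    have e : (t * v k - s * u k) ^ 2 / t
        = (1 + t) * v k ^ 2 + (1 + 1 / t) * s ^ 2 * u k ^ 2 - (v k + s * u k) ^ 2 := by
      field_simp
      ring
    linarith
  · simp

lemma le_ncSq_add_smul (d : ℕ) {s t : ℝ} (ht : 0 < t) (v u : EuclideanSpace ℝ (Fin n)) :
    (1 - t) * ncSq d v - 1 / t * s ^ 2 * ncSq d u ≤ ncSq d (v + s • u) := by
  simp only [ncSq, Finset.mul_sum, ← Finset.sum_sub_distrib]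
  refine Finset.sum_le_sum fun k _ => ?_
  split_ifs
  · simp only [PiLp.add_apply, PiLp.smul_apply, smul_eq_mul]
    have h : 0 ≤ (t * v k + s * u k) ^ 2 / t + s ^ 2 * u k ^ 2 := by positivity
    have e : (t * v k + s * u k) ^ 2 / t + s ^ 2 * u k ^ 2
        = (v k + s * u k) ^ 2 - ((1 - t) * v k ^ 2 - 1 / t * s ^ 2 * u k ^ 2) := by
      field_simp
      ring
    linarith
  · simp

lemma naSq_diagonal_le {d : ℕ} {D : Fin n → ℝ} {a : ℝ}
    (h0 : ∀ k, 0 ≤ D k) (hD : ∀ k : Fin n, (k : ℕ) < d → D k ≤ a)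
    (w : EuclideanSpace ℝ (Fin n)) :
    naSq d (Matrix.toEuclideanLin (Matrix.diagonal D) w) ≤ a ^ 2 * naSq d w := by
  simp only [naSq, Finset.mul_sum]
  refine Finset.sum_le_sum fun k _ => ?_
  split_ifs with hk
  · simp only [Matrix.toLpLin_apply, Matrix.mulVec_diagonal, mul_pow]
    exact mul_le_mul_of_nonneg_right (pow_le_pow_left₀ (h0 k) (hD k hk) 2) (sq_nonneg _)
  · simp

lemma le_ncSq_diagonal {d : ℕ} {D : Fin n → ℝ} {b : ℝ} (hb : 0 ≤ b)
    (hD : ∀ k : Fin n, d ≤ (k : ℕ) → b ≤ D k) (w : EuclideanSpace ℝ (Fin n)) :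
    b ^ 2 * ncSq d w ≤ ncSq d (Matrix.toEuclideanLin (Matrix.diagonal D) w) := by
  simp only [ncSq, Finset.mul_sum]
  refine Finset.sum_le_sum fun k _ => ?_
  split_ifs with hk
  · simp only [Matrix.toLpLin_apply, Matrix.mulVec_diagonal, mul_pow]
    exact mul_le_mul_of_nonneg_right (pow_le_pow_left₀ hb (hD k hk) 2) (sq_nonneg _)
  · simp

end SplitNorms

lemma norm_toEuclideanLin_of_mem_orthogonalGroup {n : ℕ} {O : Matrix (Fin n) (Fin n) ℝ}
    (hO : O ∈ Matrix.orthogonalGroup (Fin n) ℝ) (v : EuclideanSpace ℝ (Fin n)) :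
    ‖Matrix.toEuclideanLin O v‖ = ‖v‖ := by
  have h : ‖Matrix.toEuclideanLin O v‖ ^ 2 = ‖v‖ ^ 2 := by
    rw [EuclideanSpace.real_norm_sq_eq, EuclideanSpace.real_norm_sq_eq]
    have key : (O *ᵥ v.ofLp) ⬝ᵥ (O *ᵥ v.ofLp) = v.ofLp ⬝ᵥ v.ofLp := by
      rw [Matrix.dotProduct_mulVec, Matrix.vecMul_mulVec, (Matrix.mem_orthogonalGroup_iff' _ _).1 hO,
        Matrix.vecMul_one]
    simpa [dotProduct, sq, Matrix.toLpLin_apply] using key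
  exact (sq_eq_sq₀ (norm_nonneg _) (norm_nonneg _)).1 h

/-- If the gap of the diagonal matrix `D` at position `d` dominates the perturbation size `s`,
then the cone `naSq d ≤ ncSq d` is mapped strictly into itself. -/
lemma cone_contraction {L d : ℕ} {D : Fin (L + 1) → ℝ} {a b s m : ℝ}
    (h0 : ∀ k, 0 ≤ D k) (hDa : ∀ k : Fin (L + 1), (k : ℕ) < d → D k ≤ a)
    (hDb : ∀ k : Fin (L + 1), d ≤ (k : ℕ) → b ≤ D k)
    (ha : 0 < a) (hm : 0 < m) (hm' : m ≤ 1 / 2) (hab : (1 + m) * a ≤ b)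
    (hs : 0 ≤ s) (hsm : s ≤ m / 16)
    {O : Matrix (Fin (L + 1)) (Fin (L + 1)) ℝ} (hO : O ∈ Matrix.orthogonalGroup (Fin (L + 1)) ℝ)
    {v : Sph L} (hv : naSq d v.1 ≤ ncSq d v.1) :
    (1 + m / 2) * naSq d (actS (Matrix.diagonal D * (1 + s • O)) v).1
      ≤ ncSq d (actS (Matrix.diagonal D * (1 + s • O)) v).1 := by
  set T := Matrix.diagonal D * (1 + s • O) with hT
  set u := Matrix.toEuclideanLin O v.1 with hu
  have hv1 : ‖v.1‖ = 1 := mem_sphere_zero_iff_norm.1 v.2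
  have hu1 : ‖u‖ = 1 := by rw [hu, norm_toEuclideanLin_of_mem_orthogonalGroup hO, hv1]
  have hTv : Matrix.toEuclideanLin T v.1
      = Matrix.toEuclideanLin (Matrix.diagonal D) (v.1 + s • u) := by
    ext k
    simp [hT, hu, Matrix.toLpLin_apply]
  have hvs := naSq_add_ncSq d v.1
  have hus := naSq_add_ncSq d u
  rw [hv1] at hvs
  rw [hu1] at hus
  have hua := naSq_nonneg d u
  have huc := ncSq_nonneg d u
  have ht : (0 : ℝ) < m / 8 := by positivity
  have hs2 : s ^ 2 ≤ (m / 16) ^ 2 := pow_le_pow_left₀ hs hsm 2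
  have hst : 1 / (m / 8) * s ^ 2 ≤ m / 32 := by
    rw [one_div, inv_mul_le_iff₀ ht]
    linarith
  have hst0 : 0 ≤ 1 / (m / 8) * s ^ 2 := by positivity
  have hA : naSq d (v.1 + s • u) ≤ 1 / 2 + m / 8 := by
    refine (naSq_add_smul_le d ht v.1 u).trans ?_
    have h1 : (1 + m / 8) * naSq d v.1 ≤ (1 + m / 8) * (1 / 2) :=
      mul_le_mul_of_nonneg_left (by linarith) (by positivity)
    have h2 : (1 + 1 / (m / 8)) * s ^ 2 * naSq d u ≤ (m / 32 + (m / 16) ^ 2) * 1 :=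
      mul_le_mul (by linarith) (by linarith) hua (by positivity)
    nlinarith
  have hC : 1 / 2 - m / 8 ≤ ncSq d (v.1 + s • u) := by
    refine le_trans ?_ (le_ncSq_add_smul d ht v.1 u)
    have h1 : (1 - m / 8) * (1 / 2) ≤ (1 - m / 8) * ncSq d v.1 :=
      mul_le_mul_of_nonneg_left (by linarith) (by linarith)
    have h2 : 1 / (m / 8) * s ^ 2 * ncSq d u ≤ m / 32 * 1 :=
      mul_le_mul hst (by linarith) huc (by positivity)
    linarith
  have hb : 0 < b := lt_of_lt_of_le (by positivity) hab
  have hA' : naSq d (Matrix.toEuclideanLin T v.1) ≤ a ^ 2 * (1 / 2 + m / 8) := by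
    rw [hTv]
    exact (naSq_diagonal_le h0 hDa _).trans (mul_le_mul_of_nonneg_left hA (sq_nonneg a))
  have hC' : b ^ 2 * (1 / 2 - m / 8) ≤ ncSq d (Matrix.toEuclideanLin T v.1) := by
    rw [hTv]
    exact (mul_le_mul_of_nonneg_left hC (sq_nonneg b)).trans (le_ncSq_diagonal hb.le hDb _)
  have hC0 : 0 < ncSq d (Matrix.toEuclideanLin T v.1) :=
    lt_of_lt_of_le (mul_pos (by positivity) (by linarith)) hC'
  have hnum : (1 + m / 2) * (1 / 2 + m / 8) ≤ (1 + m) ^ 2 * (1 / 2 - m / 8) := by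
    nlinarith [mul_pos hm hm, mul_nonneg (mul_pos hm hm).le (sub_nonneg.2 hm')]
  have hab2 : (1 + m) ^ 2 * a ^ 2 ≤ b ^ 2 := by
    rw [← mul_pow]
    exact pow_le_pow_left₀ (by positivity) hab 2
  have main : (1 + m / 2) * naSq d (Matrix.toEuclideanLin T v.1)
      ≤ ncSq d (Matrix.toEuclideanLin T v.1) :=
    calc (1 + m / 2) * naSq d (Matrix.toEuclideanLin T v.1)
        ≤ (1 + m / 2) * (a ^ 2 * (1 / 2 + m / 8)) :=
          mul_le_mul_of_nonneg_left hA' (by positivity)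
      _ = a ^ 2 * ((1 + m / 2) * (1 / 2 + m / 8)) := by ring
      _ ≤ a ^ 2 * ((1 + m) ^ 2 * (1 / 2 - m / 8)) :=
          mul_le_mul_of_nonneg_left hnum (sq_nonneg a)
      _ = (1 + m) ^ 2 * a ^ 2 * (1 / 2 - m / 8) := by ring
      _ ≤ b ^ 2 * (1 / 2 - m / 8) := mul_le_mul_of_nonneg_right hab2 (by linarith)
      _ ≤ _ := hC'
  have hne : ‖Matrix.toEuclideanLin T v.1‖ ≠ 0 := by
    intro h
    have := naSq_add_ncSq d (Matrix.toEuclideanLin T v.1)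
    rw [h] at this
    linarith [naSq_nonneg d (Matrix.toEuclideanLin T v.1)]
  rw [actS, dif_neg hne]
  simp only [act, naSq_smul, ncSq_smul]
  rw [mul_left_comm]
  exact mul_le_mul_of_nonneg_left main (sq_nonneg _)

lemma exists_mem_sphere_between_cones {L d : ℕ} (hd : 1 ≤ d) (hdL : d ≤ L) {ε : ℝ} (hε : 0 < ε)
    (hε' : ε ≤ 1) :
    ∃ v : Sph L, naSq d v.1 < ncSq d v.1 ∧ ncSq d v.1 < (1 + ε) * naSq d v.1 := by
  set α := √(1 / 2 - ε / 8)
  set β := √(1 / 2 + ε / 8)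
  have hα : α ^ 2 = 1 / 2 - ε / 8 := Real.sq_sqrt (by linarith)
  have hβ : β ^ 2 = 1 / 2 + ε / 8 := Real.sq_sqrt (by linarith)
  set w : EuclideanSpace ℝ (Fin (L + 1)) :=
    WithLp.toLp 2 fun k => if k = 0 then α else if k = Fin.last L then β else 0 with hw
  have hL0 : Fin.last L ≠ 0 := by
    intro h
    have := congrArg Fin.val h
    simp at this
    omega
  have ha : naSq d w = 1 / 2 - ε / 8 := by
    rw [naSq, Finset.sum_eq_single 0]
    · simpa [hw, show 0 < d from hd] using hα
    · intro k _ hk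
      by_cases hk' : k = Fin.last L
      · simp [hk', not_lt.2 hdL]
      · simp [hw, hk, hk']
    · simp
  have hc : ncSq d w = 1 / 2 + ε / 8 := by
    rw [ncSq, Finset.sum_eq_single (Fin.last L)]
    · simpa [hw, hL0, hdL] using hβ
    · intro k _ hk
      by_cases hk' : k = 0
      · simp [hk', Nat.one_le_iff_ne_zero.1 hd]
      · simp [hw, hk, hk']
    · simp
  have hn : ‖w‖ ^ 2 = 1 := by rw [← naSq_add_ncSq d w, ha, hc]; ring
  refine ⟨⟨w, mem_sphere_zero_iff_norm.2 ?_⟩, ?_, ?_⟩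
  · exact (pow_eq_one_iff_of_nonneg (norm_nonneg w) two_ne_zero).1 hn
  · simp only [ha, hc]; linarith
  · simp only [ha, hc]; nlinarith

/-- If a Markov transition almost surely sends `C` into `C'`, then an invariant measure gives
at least as much mass to `C'` as to `C`. -/
lemma measure_le_of_transition {X Ω : Type*} [MeasurableSpace X] [MeasurableSpace Ω]
    {P : Measure Ω} [IsProbabilityMeasure P] {μ : Measure X} {F : Ω → X → X}
    {C C' : Set X} (hC : MeasurableSet C)
    (hinv : μ C' = ∫⁻ v, P {ω | F ω v ∈ C'} ∂μ) (hF : ∀ v ∈ C, ∀ ω, F ω v ∈ C') :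
    μ C ≤ μ C' := by
  rw [hinv, ← lintegral_indicator_one hC]
  refine lintegral_mono fun v => ?_
  by_cases hv : v ∈ C
  · have h : {ω | F ω v ∈ C'} = Set.univ := Set.eq_univ_of_forall (hF v hv)
    simp [hv, h]
  · simp [hv]

theorem stmt2 {L : ℕ} (hL : 2 ≤ L) {Ω : Type*} [MeasurableSpace Ω]
    (P : Measure Ω) [IsProbabilityMeasure P]
    (lam : ℝ) (hlam : lam ∈ Set.Ioo (0:ℝ) 1)
    (r : Ω → ℝ) (hr : Measurable r) (hr01 : ∀ ω, r ω ∈ Set.Icc (0:ℝ) 1)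
    (hr0 : P {ω | r ω = 0} < 1)
    (U : Ω → Matrix (Fin (L+1)) (Fin (L+1)) ℝ) (hU : IsHaarOrth P U)
    (hrU : IndepFun r U P)
    (κ : ℕ → ℝ) (hκpos : ∀ i, 1 ≤ i → i ≤ L+1 → 0 < κ i)
    (hκmono : ∀ i j, 1 ≤ i → i ≤ j → j ≤ L+1 → κ j ≤ κ i)
    (R : Matrix (Fin (L+1)) (Fin (L+1)) ℝ)
    (hR : R = Matrix.diagonal fun k : Fin (L+1) => κ (L+1-(k:ℕ)))
    (hsmall : ∃ i, 1 ≤ i ∧ i ≤ L ∧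
      lam < (1/16 : ℝ) * min ((κ i - κ (i+1)) / κ (i+1)) (1/2))
    (μ : Measure (Sph L)) [IsProbabilityMeasure μ]
    (hinv : ∀ A : Set (Sph L), MeasurableSet A →
      μ A = ∫⁻ v, P {ω | actS (R * (1 + (lam * r ω) • U ω)) v ∈ A} ∂μ) :
    msupport μ ≠ (Set.univ : Set (Sph L)) := by
  obtain ⟨i, hi1, hiL, hsm⟩ := hsmall
  set m := min ((κ i - κ (i + 1)) / κ (i + 1)) (1 / 2) with hm
  have hm0 : 0 < m := by linarith [hlam.1]
  have hm2 : m ≤ 1 / 2 := min_le_right _ _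
  have ha : 0 < κ (i + 1) := hκpos _ (by omega) (by omega)
  have hab : (1 + m) * κ (i + 1) ≤ κ i := by
    have h := (le_div_iff₀ ha).1 (min_le_left ((κ i - κ (i + 1)) / κ (i + 1)) (1 / 2))
    rw [← hm] at h
    linarith
  set d := L + 1 - i with hd
  have hna : Continuous fun v : Sph L => naSq d v.1 :=
    (continuous_naSq d).comp continuous_subtype_val
  have hnc : Continuous fun v : Sph L => ncSq d v.1 :=
    (continuous_ncSq d).comp continuous_subtype_val
  set C : Set (Sph L) := {v | naSq d v.1 ≤ ncSq d v.1}
  set C' : Set (Sph L) := {v | (1 + m / 2) * naSq d v.1 ≤ ncSq d v.1}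
  set W : Set (Sph L) := {v | naSq d v.1 < ncSq d v.1} ∩
    {v | ncSq d v.1 < (1 + m / 2) * naSq d v.1}
  have hC : MeasurableSet C := (isClosed_le hna hnc).measurableSet
  have hC' : MeasurableSet C' := (isClosed_le (hna.const_mul _) hnc).measurableSet
  have hW : IsOpen W := (isOpen_lt hna hnc).inter (isOpen_lt hnc (hna.const_mul _))
  have hle : μ C ≤ μ C' := by
    refine measure_le_of_transition hC (hinv C' hC') fun v hv ω => ?_
    rw [hR]
    refine cone_contraction (fun k => (hκpos _ (by omega) (by omega)).le)
      (fun k hk => hκmono _ _ (by omega) (by omega) (by omega))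
      (fun k hk => hκmono _ _ (by omega) (by omega) (by omega)) ha hm0 hm2 hab
      (mul_nonneg hlam.1.le (hr01 ω).1) ?_ (hU.2.1 ω) hv
    exact (mul_le_of_le_one_right hlam.1.le (hr01 ω).2).trans (by linarith)
  have hsub : C' ∪ W ⊆ C := by
    rintro v (hv | hv)
    · have h1 : (1 + m / 2) * naSq d v.1 ≤ ncSq d v.1 := hv
      have h2 : 0 ≤ m / 2 * naSq d v.1 := mul_nonneg (by positivity) (naSq_nonneg d v.1)
      exact (show naSq d v.1 ≤ ncSq d v.1 by linarith)
    · exact le_of_lt (show naSq d v.1 < ncSq d v.1 from hv.1)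
  have hdisj : Disjoint C' W :=
    Set.disjoint_left.2 fun v hv hvW => not_lt_of_ge
      (show (1 + m / 2) * naSq d v.1 ≤ ncSq d v.1 from hv) hvW.2
  have hsum : μ C' + μ W ≤ μ C' + 0 := by
    rw [← measure_union hdisj hW.measurableSet, add_zero]
    exact (measure_mono hsub).trans hle
  have hW0 : μ W = 0 :=
    le_antisymm ((ENNReal.add_le_add_iff_left (measure_ne_top μ C')).1 hsum) zero_le
  intro huniv
  obtain ⟨v, hv1, hv2⟩ := exists_mem_sphere_between_cones (L := L) (d := d) (ε := m / 2)
    (by omega) (by omega) (by positivity) (by linarith)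
  have hv : v ∈ msupport μ := huniv ▸ Set.mem_univ v
  exact (hv W hW ⟨hv1, hv2⟩).ne' hW0
end
end

section
/- Suppose λ > δℛ_i for all i = 1,…,L and 1 lies in the support of the distribution of r. Then the support of every invariant probability measure μ on 𝕊^L (i.e. every μ with μ(A) = ∫_{𝕊^L} P(ℛ(1+λrU)·v ∈ A) dμ(v) for all Borel A) is the whole sphere 𝕊^L. -/
open MeasureTheory ProbabilityTheory Matrix Real
open scoped ENNReal

noncomputable section

section DiagonalDynamics

lemma single_zero_coord {n : ℕ} (k : Fin n) :
    (EuclideanSpace.single k 0 : EuclideanSpace ℝ (Fin n)) = 0 := by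
  simp

lemma smul_single_coord {n : ℕ} (k : Fin n) (c d : ℝ) :
    c • (EuclideanSpace.single k d : EuclideanSpace ℝ (Fin n)) =
      EuclideanSpace.single k (c * d) := by
  ext i
  rcases eq_or_ne i k with rfl | h
  · simp
  · simp [h]

variable {n : ℕ} {a : Fin n → ℝ} {D : EuclideanSpace ℝ (Fin n) →ₗ[ℝ] EuclideanSpace ℝ (Fin n)}

lemma norm_diag_le (hD : ∀ x i, D x i = a i * x i) {c : ℝ} (ha : ∀ i, 0 ≤ a i)
    (hac : ∀ i, a i ≤ c) (hc : 0 ≤ c) (x : EuclideanSpace ℝ (Fin n)) : ‖D x‖ ≤ c * ‖x‖ := by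
  refine abs_le_of_sq_le_sq' ?_ (by positivity) |>.2
  rw [mul_pow, EuclideanSpace.real_norm_sq_eq, EuclideanSpace.real_norm_sq_eq, Finset.mul_sum]
  refine Finset.sum_le_sum fun i _ => ?_
  rw [hD, mul_pow]
  have := ha i
  have := hac i
  gcongr

lemma le_norm_diag (hD : ∀ x i, D x i = a i * x i) {c : ℝ} (hca : ∀ i, c ≤ a i) (hc : 0 ≤ c)
    (x : EuclideanSpace ℝ (Fin n)) : c * ‖x‖ ≤ ‖D x‖ := by
  refine abs_le_of_sq_le_sq' ?_ (norm_nonneg _) |>.2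
  rw [mul_pow, EuclideanSpace.real_norm_sq_eq, EuclideanSpace.real_norm_sq_eq, Finset.mul_sum]
  refine Finset.sum_le_sum fun i _ => ?_
  rw [hD, mul_pow]
  have := hca i
  gcongr

lemma diag_single (hD : ∀ x i, D x i = a i * x i) (k : Fin n) (c : ℝ) :
    D (EuclideanSpace.single k c) = EuclideanSpace.single k (a k * c) := by
  ext i
  rw [hD]
  rcases eq_or_ne i k with rfl | h
  · simp
  · simp [h]

/-- The part of `x` orthogonal to the `k`-th coordinate axis. -/
def offAxis (k : Fin n) (x : EuclideanSpace ℝ (Fin n)) : EuclideanSpace ℝ (Fin n) :=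
  x - EuclideanSpace.single k (x k)

lemma offAxis_add_single (k : Fin n) (x : EuclideanSpace ℝ (Fin n)) (s : ℝ) :
    offAxis k (x + EuclideanSpace.single k s) = offAxis k x := by
  ext i
  rcases eq_or_ne i k with rfl | h
  · simp [offAxis]
  · simp [offAxis, h]

lemma offAxis_diag (hD : ∀ x i, D x i = a i * x i) (k : Fin n) (x : EuclideanSpace ℝ (Fin n)) :
    offAxis k (D x) = D (offAxis k x) := by
  rw [offAxis, offAxis, map_sub, diag_single hD, hD]

lemma norm_offAxis_le (k : Fin n) (x : EuclideanSpace ℝ (Fin n)) : ‖offAxis k x‖ ≤ ‖x‖ := by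
  refine abs_le_of_sq_le_sq' ?_ (norm_nonneg _) |>.2
  rw [EuclideanSpace.real_norm_sq_eq, EuclideanSpace.real_norm_sq_eq]
  refine Finset.sum_le_sum fun i _ => ?_
  rcases eq_or_ne i k with rfl | h
  · simpa [offAxis] using sq_nonneg (x i)
  · simp [offAxis, h]

lemma exists_abs_eq_and_abs_add_eq (t : ℝ) {s : ℝ} (hs : 0 ≤ s) :
    ∃ u : ℝ, |u| = s ∧ |t + u| = |t| + s := by
  rcases le_total 0 t with h | h
  · exact ⟨s, abs_of_nonneg hs, by rw [abs_of_nonneg h, abs_of_nonneg (by positivity)]⟩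
  · exact ⟨-s, by rw [abs_neg, abs_of_nonneg hs], by
      rw [abs_of_nonpos h, abs_of_nonpos (by linarith)]; ring⟩

variable {lam : ℝ} {K : Set (EuclideanSpace ℝ (Fin n))}

/-- Pushing towards the axis of the largest eigenvalue, one hits that axis exactly. -/
lemma exists_single_mem_of_top (hD : ∀ x i, D x i = a i * x i) (hlam : 0 < lam)
    (ha : ∀ i, 0 < a i) (hK0 : 0 ∉ K)
    (hstep : ∀ x ∈ K, ∀ w, ‖w‖ ≤ lam * ‖x‖ → D (x + w) ∈ K)
    {k : Fin n} (hk : ∀ i, a i ≤ a k) (m : ℕ) :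
    ∀ x ∈ K, (lam⁻¹ - m * lam) * ‖offAxis k x‖ ≤ |x k| →
      ∃ c : ℝ, c ≠ 0 ∧ EuclideanSpace.single k c ∈ K := by
  induction m with
  | zero =>
    intro x hx h
    have hw : ‖-offAxis k x‖ ≤ lam * ‖x‖ := by
      rw [norm_neg]
      have h1 : ‖offAxis k x‖ ≤ lam * |x k| := by
        rw [Nat.cast_zero, zero_mul, sub_zero, inv_mul_le_iff₀ hlam] at h
        exact h
      have h2 : |x k| ≤ ‖x‖ := PiLp.norm_apply_le x k
      nlinarith
    have h3 := hstep x hx _ hw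
    rw [offAxis, neg_sub, add_sub_cancel, diag_single hD] at h3
    refine ⟨_, ?_, h3⟩
    intro h0
    rw [h0] at h3
    exact hK0 (by rwa [single_zero_coord k] at h3)
  | succ m ih =>
    intro x hx h
    obtain ⟨u, hu, hxu⟩ := exists_abs_eq_and_abs_add_eq (x k)
      (mul_nonneg hlam.le (norm_nonneg x))
    refine ih _ (hstep x hx (EuclideanSpace.single k u) ?_) ?_
    · simp [hu]
    · rw [offAxis_diag hD, offAxis_add_single, hD]
      have h1 := norm_diag_le hD (fun i => (ha i).le) hk (ha k).le (offAxis k x)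
      have h2 := norm_offAxis_le k x
      have h3 : |a k * (x + EuclideanSpace.single k u) k| = a k * (|x k| + lam * ‖x‖) := by
        rw [abs_mul, abs_of_pos (ha k), ← hxu]; simp
      rw [h3]
      push_cast at h
      have h4 : (lam⁻¹ - m * lam) * ‖offAxis k x‖ ≤ |x k| + lam * ‖x‖ := by nlinarith
      rcases le_total (lam⁻¹ - m * lam) 0 with h5 | h5
      · exact (mul_nonpos_of_nonpos_of_nonneg h5 (norm_nonneg _)).trans
          (mul_nonneg (ha k).le (by positivity))
      · calc _ ≤ (lam⁻¹ - m * lam) * (a k * ‖offAxis k x‖) := by gcongr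
          _ = a k * ((lam⁻¹ - m * lam) * ‖offAxis k x‖) := by ring
          _ ≤ _ := by have := ha k; gcongr

/-- From the axis of the smallest eigenvalue one reaches every nonzero vector. -/
lemma mem_of_bot (hD : ∀ x i, D x i = a i * x i) (hlam : 0 < lam)
    (ha : ∀ i, 0 < a i)
    (hstep : ∀ x ∈ K, ∀ w, ‖w‖ ≤ lam * ‖x‖ → D (x + w) ∈ K)
    {k : Fin n} (hk : ∀ i, a k ≤ a i)
    (hsingle : ∀ c : ℝ, c ≠ 0 → EuclideanSpace.single k c ∈ K) (m : ℕ) :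
    ∀ y, y ≠ 0 → (lam⁻¹ - m * lam) * ‖offAxis k y‖ ≤ |y k| → y ∈ K := by
  have hsurj : ∀ y, ∃ z, D z = y := fun y =>
    ⟨WithLp.toLp 2 fun i => (a i)⁻¹ * y i, by
      ext i; rw [hD]; exact mul_inv_cancel_left₀ (ha i).ne' _⟩
  induction m with
  | zero =>
    intro y hy h
    obtain ⟨z, rfl⟩ := hsurj y
    rw [offAxis_diag hD, hD, abs_mul, abs_of_pos (ha k), Nat.cast_zero, zero_mul, sub_zero,
      inv_mul_le_iff₀ hlam] at h
    have h1 := le_norm_diag hD hk (ha k).le (offAxis k z)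
    have h2 : ‖offAxis k z‖ ≤ lam * |z k| := by
      refine le_of_mul_le_mul_left ?_ (ha k)
      linarith
    have hz : z k ≠ 0 := by
      intro h0
      apply hy
      have h3 : offAxis k z = 0 := by
        rw [← norm_le_zero_iff]; simpa [h0] using h2
      rw [offAxis, h0, sub_eq_zero] at h3
      rw [h3, single_zero_coord k, map_zero]
    have h4 := hstep _ (hsingle _ hz) (offAxis k z) (by simpa using h2)
    rwa [offAxis, add_sub_cancel] at h4
  | succ m ih =>
    intro y hy h
    obtain ⟨z, rfl⟩ := hsurj y
    have hz : z ≠ 0 := by rintro rfl; simp at hy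
    have hz' := norm_pos_iff.2 hz
    rw [offAxis_diag hD, hD, abs_mul, abs_of_pos (ha k)] at h
    obtain ⟨u, hu, hzu⟩ := exists_abs_eq_and_abs_add_eq (z k)
      (mul_nonneg hlam.le (norm_nonneg z))
    have hk' : (z + EuclideanSpace.single k u) k = z k + u := by simp
    have hu0 : 0 < |z k + u| := by rw [hzu]; positivity
    have hle : ‖z‖ ≤ ‖z + EuclideanSpace.single k u‖ := by
      refine abs_le_of_sq_le_sq' ?_ (norm_nonneg _) |>.2
      rw [EuclideanSpace.real_norm_sq_eq, EuclideanSpace.real_norm_sq_eq]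
      refine Finset.sum_le_sum fun i _ => ?_
      rcases eq_or_ne i k with rfl | hik
      · rw [hk', sq_le_sq, hzu]
        have : 0 ≤ lam * ‖z‖ := by positivity
        linarith
      · simp [hik]
    have h1 := le_norm_diag hD hk (ha k).le (offAxis k z)
    have h2 := norm_offAxis_le k z
    have hx : z + EuclideanSpace.single k u ∈ K := by
      refine ih _ ?_ ?_
      · intro h0
        rw [← hk', h0] at hu0
        simp at hu0
      · rw [offAxis_add_single, hk', hzu]
        have h5 : (lam⁻¹ - (m + 1) * lam) * ‖offAxis k z‖ ≤ |z k| := by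
          push_cast at h
          rcases le_total (lam⁻¹ - (m + 1) * lam) 0 with h5 | h5
          · exact (mul_nonpos_of_nonpos_of_nonneg h5 (norm_nonneg _)).trans (abs_nonneg _)
          · refine le_of_mul_le_mul_left ?_ (ha k)
            calc _ = (lam⁻¹ - (m + 1) * lam) * (a k * ‖offAxis k z‖) := by ring
              _ ≤ (lam⁻¹ - (m + 1) * lam) * ‖D (offAxis k z)‖ := by gcongr
              _ ≤ _ := h
        nlinarith
    have h6 := hstep _ hx (-EuclideanSpace.single k u) (by
      rw [norm_neg, PiLp.norm_single, Real.norm_eq_abs, hu]; gcongr)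
    rwa [add_neg_cancel_right] at h6

/-- Inside the plane spanned by two coordinate axes, one can move from one axis to the other as
soon as the ratio of the eigenvalues is less than `1 + lam`. -/
lemma exists_smul_single_mem_of_plane (hD : ∀ x i, D x i = a i * x i) (hlam : 0 < lam)
    (ha : ∀ i, 0 < a i)
    (hstep : ∀ x ∈ K, ∀ w, ‖w‖ ≤ lam * ‖x‖ → D (x + w) ∈ K)
    {j k : Fin n} (hjk : j ≠ k) (m : ℕ) :
    ∀ p q : ℝ, |p| ≤ lam * ((1 + lam) * a k / a j) ^ m * |q| →
      EuclideanSpace.single j p + EuclideanSpace.single k q ∈ K →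
      ∃ c : ℝ, 0 < c ∧ EuclideanSpace.single k (c * q) ∈ K := by
  have hnorm : ∀ p q : ℝ, |q| ≤
      ‖(EuclideanSpace.single j p + EuclideanSpace.single k q : EuclideanSpace ℝ (Fin n))‖ := by
    intro p q
    simpa [hjk.symm] using PiLp.norm_apply_le
      (EuclideanSpace.single j p + EuclideanSpace.single k q : EuclideanSpace ℝ (Fin n)) k
  induction m with
  | zero =>
    intro p q h hx
    have h1 := hstep _ hx (-EuclideanSpace.single j p) (by
      rw [norm_neg, PiLp.norm_single, Real.norm_eq_abs]
      rw [pow_zero, mul_one] at h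
      exact h.trans (by gcongr; exact hnorm p q))
    rw [add_neg_cancel_comm, diag_single hD] at h1
    exact ⟨a k, ha k, h1⟩
  | succ m ih =>
    intro p q h hx
    have h1 := hstep _ hx (EuclideanSpace.single k (lam * q)) (by
      rw [PiLp.norm_single, Real.norm_eq_abs, abs_mul, abs_of_pos hlam]
      gcongr; exact hnorm p q)
    rw [add_assoc, ← PiLp.single_add, map_add, diag_single hD, diag_single hD] at h1
    obtain ⟨c, hc, hcK⟩ := ih _ _ (by
      have haj := ha j
      have hak := ha k
      rw [abs_mul, abs_mul, abs_of_pos haj, abs_of_pos hak,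
        show q + lam * q = (1 + lam) * q by ring, abs_mul,
        abs_of_pos (by positivity : 0 < 1 + lam)]
      calc a j * |p| ≤ a j * (lam * ((1 + lam) * a k / a j) ^ (m + 1) * |q|) := by gcongr
        _ = _ := by rw [pow_succ]; field_simp) h1
    refine ⟨c * (a k * (1 + lam)), by have := ha k; positivity, ?_⟩
    convert hcK using 2
    ring

end DiagonalDynamics

/-- A cone which is stable under relative perturbations of size `lam` followed by a diagonal matrix
with successive eigenvalue ratios less than `1 + lam` contains all nonzero vectors. -/
lemma mem_of_diag_dynamics {L : ℕ} (hL : 1 ≤ L) {a : Fin (L + 1) → ℝ}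
    {D : EuclideanSpace ℝ (Fin (L + 1)) →ₗ[ℝ] EuclideanSpace ℝ (Fin (L + 1))}
    (hD : ∀ x i, D x i = a i * x i) {lam : ℝ} (hlam : 0 < lam)
    (ha : ∀ i, 0 < a i) (hmono : Monotone a)
    (hratio : ∀ i : Fin L, a i.succ < (1 + lam) * a i.castSucc)
    {K : Set (EuclideanSpace ℝ (Fin (L + 1)))} (hK0 : 0 ∉ K) (hKne : K.Nonempty)
    (hsmul : ∀ c : ℝ, 0 < c → ∀ x ∈ K, c • x ∈ K)
    (hstep : ∀ x ∈ K, ∀ w, ‖w‖ ≤ lam * ‖x‖ → D (x + w) ∈ K)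
    {y : EuclideanSpace ℝ (Fin (L + 1))} (hy : y ≠ 0) : y ∈ K := by
  have hbig : ∃ m : ℕ, lam⁻¹ - m * lam ≤ 0 := by
    obtain ⟨m, hm⟩ := exists_nat_ge (lam⁻¹ / lam)
    exact ⟨m, by rw [div_le_iff₀ hlam] at hm; linarith⟩
  obtain ⟨m, hm⟩ := hbig
  obtain ⟨x, hx⟩ := hKne
  have htop := exists_single_mem_of_top hD hlam ha hK0 hstep (k := Fin.last L)
    (fun i => hmono (Fin.le_last i)) m x hx
    ((mul_nonpos_of_nonpos_of_nonneg hm (norm_nonneg _)).trans (abs_nonneg _))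
  have hmove : ∀ i : Fin L, (∃ c : ℝ, c ≠ 0 ∧ EuclideanSpace.single i.succ c ∈ K) →
      ∀ d : ℝ, d ≠ 0 → EuclideanSpace.single i.castSucc d ∈ K := by
    rintro i ⟨c, hc, hcK⟩ d hd
    have hak := ha i.castSucc
    have haj := ha i.succ
    set q := d / |d| * (lam * |c|) with hq
    have hqd : |q| = lam * |c| := by
      rw [hq, abs_mul, abs_div, abs_abs, div_self (abs_ne_zero.2 hd), one_mul, abs_mul, abs_abs,
        abs_of_pos hlam]
    have h1 := hstep _ hcK (EuclideanSpace.single i.castSucc q) (by simp [hqd])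
    rw [map_add, diag_single hD, diag_single hD] at h1
    have hβ : 1 < (1 + lam) * a i.castSucc / a i.succ := by
      rw [one_lt_div haj]; exact hratio i
    have hc0 : 0 < |c| := abs_pos.2 hc
    obtain ⟨l, hl⟩ := pow_unbounded_of_one_lt
      (a i.succ * |c| / (lam * (a i.castSucc * (lam * |c|)))) hβ
    rw [div_lt_iff₀ (by positivity)] at hl
    obtain ⟨b, hb, hbK⟩ := exists_smul_single_mem_of_plane hD hlam ha hstep
      (Fin.castSucc_lt_succ (i := i)).ne' l _ _ (by
        rw [abs_mul, abs_mul, abs_of_pos haj, abs_of_pos hak, hqd]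
        linarith) h1
    have hd0 : 0 < |d| := abs_pos.2 hd
    convert hsmul (|d| / (b * a i.castSucc * (lam * |c|))) (by positivity) _ hbK using 1
    rw [smul_single_coord]
    congr 1
    rw [hq]
    field_simp
  have hall : ∀ i : Fin (L + 1), ∃ c : ℝ, c ≠ 0 ∧ EuclideanSpace.single i c ∈ K := by
    intro i
    induction i using Fin.reverseInduction with
    | last => exact htop
    | cast i ih => exact ⟨1, one_ne_zero, hmove i ih 1 one_ne_zero⟩
  refine mem_of_bot hD hlam ha hstep (k := 0) (fun i => hmono (Fin.zero_le i)) ?_ m y hy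
    ((mul_nonpos_of_nonpos_of_nonneg hm (norm_nonneg _)).trans (abs_nonneg _))
  exact hmove ⟨0, hL⟩ (hall _)

instance {m n α : Type*} [Finite m] [Finite n] [MeasurableSpace α] [TopologicalSpace α]
    [SecondCountableTopology α] [BorelSpace α] : BorelSpace (Matrix m n α) :=
  haveI := Fintype.ofFinite m
  haveI := Fintype.ofFinite n
  inferInstanceAs (BorelSpace (m → n → α))

instance {m n α : Type*} [Finite m] [Finite n] [TopologicalSpace α]
    [SecondCountableTopology α] : SecondCountableTopology (Matrix m n α) :=
  inferInstanceAs (SecondCountableTopology (m → n → α))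

lemma exists_orthogonal_toEuclideanLin_eq {n : ℕ} {v w : EuclideanSpace ℝ (Fin n)}
    (h : ‖v‖ = ‖w‖) :
    ∃ O ∈ Matrix.orthogonalGroup (Fin n) ℝ, Matrix.toEuclideanLin O v = w := by
  set f := (ℝ ∙ (v - w))ᗮ.reflection with hf
  set b := EuclideanSpace.basisFun (Fin n) ℝ
  refine ⟨LinearMap.toMatrix b.toBasis b.toBasis f.toLinearEquiv.toLinearMap,
    f.toMatrix_mem_unitaryGroup b b, ?_⟩
  rw [Matrix.toEuclideanLin_eq_toLin_orthonormal, Matrix.toLin_toMatrix]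
  exact Submodule.reflection_sub h

/-- The Haar measure on the orthogonal group charges every neighborhood of every point. -/
lemma IsHaarOrth.measure_preimage_pos {L : ℕ} {Ω : Type*} [MeasurableSpace Ω] {P : Measure Ω}
    [IsProbabilityMeasure P] {U : Ω → Matrix (Fin (L+1)) (Fin (L+1)) ℝ} (hU : IsHaarOrth P U)
    {O : Matrix (Fin (L+1)) (Fin (L+1)) ℝ} (hO : O ∈ Matrix.orthogonalGroup (Fin (L+1)) ℝ)
    {N : Set (Matrix (Fin (L+1)) (Fin (L+1)) ℝ)} (hN : IsOpen N) (hON : O ∈ N) :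
    0 < P (U ⁻¹' N) := by
  obtain ⟨hUm, hUO, hinv⟩ := hU
  by_contra hzero
  rw [not_lt, nonpos_iff_eq_zero, ← Measure.map_apply hUm hN.measurableSet] at hzero
  have hnull : P.map U (Matrix.orthogonalGroup (Fin (L+1)) ℝ :
      Set (Matrix (Fin (L+1)) (Fin (L+1)) ℝ)) = 0 := by
    refine measure_null_of_locally_null _ fun M hM => ?_
    have hQ : O * star M ∈ Matrix.orthogonalGroup (Fin (L+1)) ℝ := mul_mem hO (Unitary.star_mem hM)
    have hcont : Continuous fun A : Matrix (Fin (L+1)) (Fin (L+1)) ℝ => O * star M * A :=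
      continuous_const.mul continuous_id
    refine ⟨(fun A => O * star M * A) ⁻¹' N, mem_nhdsWithin_of_mem_nhds
      ((hN.preimage hcont).mem_nhds ?_), ?_⟩
    · have : star M * M = 1 := (Matrix.mem_unitaryGroup_iff').1 hM
      simpa [mul_assoc, this] using hON
    · rw [← Measure.map_apply hcont.measurable hN.measurableSet,
        Measure.map_map hcont.measurable hUm]
      exact (congrArg (fun m => m N) (hinv _ hQ)).trans hzero
  have hle := Measure.le_map_apply hUm.aemeasurable (μ := P)
    (Matrix.orthogonalGroup (Fin (L+1)) ℝ : Set (Matrix (Fin (L+1)) (Fin (L+1)) ℝ))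
  have huniv : U ⁻¹' (Matrix.orthogonalGroup (Fin (L+1)) ℝ :
      Set (Matrix (Fin (L+1)) (Fin (L+1)) ℝ)) = Set.univ := Set.eq_univ_of_forall hUO
  rw [hnull, huniv, measure_univ] at hle
  simp at hle

lemma coe_actS {L : ℕ} {T : Matrix (Fin (L+1)) (Fin (L+1)) ℝ} {v : Sph L}
    (h : Matrix.toEuclideanLin T (v : EuclideanSpace ℝ (Fin (L+1))) ≠ 0) :
    (actS T v : EuclideanSpace ℝ (Fin (L+1))) = act T v := by
  rw [actS, dif_neg (norm_ne_zero_iff.2 h)]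

lemma continuousAt_actS {L : ℕ} {X : Type*} [TopologicalSpace X]
    {T : X → Matrix (Fin (L+1)) (Fin (L+1)) ℝ} {v : X → Sph L} (hT : Continuous T)
    (hv : Continuous v) {x : X}
    (h : Matrix.toEuclideanLin (T x) (v x : EuclideanSpace ℝ (Fin (L+1))) ≠ 0) :
    ContinuousAt (fun y => actS (T y) (v y)) x := by
  have hlin : Continuous fun y =>
      Matrix.toEuclideanLin (T y) (v y : EuclideanSpace ℝ (Fin (L+1))) := by
    simp only [Matrix.toLpLin_apply]
    fun_prop
  rw [Topology.IsInducing.subtypeVal.continuousAt_iff]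
  have hev : ∀ᶠ y in nhds x,
      Matrix.toEuclideanLin (T y) (v y : EuclideanSpace ℝ (Fin (L+1))) ≠ 0 :=
    hlin.continuousAt.eventually_ne h
  refine ContinuousAt.congr (f := fun y => act (T y) (v y)) ?_
    (hev.mono fun y hy => (coe_actS hy).symm)
  exact (hlin.norm.continuousAt.inv₀ (norm_ne_zero_iff.2 h)).smul hlin.continuousAt

/-- The support of an invariant measure is stable under the action with maximal noise. -/
lemma actS_mem_msupport {L : ℕ} {Ω : Type*} [MeasurableSpace Ω]
    {P : Measure Ω} [IsProbabilityMeasure P] {lam : ℝ} {r : Ω → ℝ} (hr : Measurable r)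
    {U : Ω → Matrix (Fin (L+1)) (Fin (L+1)) ℝ} (hU : IsHaarOrth P U) (hrU : IndepFun r U P)
    {R : Matrix (Fin (L+1)) (Fin (L+1)) ℝ}
    (hone : (1:ℝ) ∈ msupport (Measure.map r P)) {μ : Measure (Sph L)}
    (hinv : ∀ A : Set (Sph L), MeasurableSet A →
      μ A = ∫⁻ v, P {ω | actS (R * (1 + (lam * r ω) • U ω)) v ∈ A} ∂μ)
    {v : Sph L} (hv : v ∈ msupport μ) {O : Matrix (Fin (L+1)) (Fin (L+1)) ℝ}
    (hO : O ∈ Matrix.orthogonalGroup (Fin (L+1)) ℝ)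
    (h : Matrix.toEuclideanLin (R * (1 + lam • O)) (v : EuclideanSpace ℝ (Fin (L+1))) ≠ 0) :
    actS (R * (1 + lam • O)) v ∈ msupport μ := by
  intro s hs hmem
  have hcont : ContinuousAt (fun p : Sph L × ℝ × Matrix (Fin (L+1)) (Fin (L+1)) ℝ =>
      actS (R * (1 + (lam * p.2.1) • p.2.2)) p.1) (v, 1, O) :=
    continuousAt_actS (by fun_prop) (by fun_prop) (by simpa using h)
  have hnhds := hcont.preimage_mem_nhds (hs.mem_nhds (by simpa using hmem))
  rw [nhds_prod_eq, nhds_prod_eq] at hnhds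
  obtain ⟨V, hV, B, hB, hVB⟩ := Filter.mem_prod_iff.1 hnhds
  obtain ⟨W, hW, N, hN, hWN⟩ := Filter.mem_prod_iff.1 hB
  obtain ⟨V', hV'V, hV'o, hvV'⟩ := mem_nhds_iff.1 hV
  obtain ⟨W', hW'W, hW'o, hW'1⟩ := mem_nhds_iff.1 hW
  obtain ⟨N', hN'N, hN'o, hN'O⟩ := mem_nhds_iff.1 hN
  have hWpos : 0 < P (r ⁻¹' W') := by
    rw [← Measure.map_apply hr hW'o.measurableSet]
    exact hone W' hW'o hW'1
  have hNpos := hU.measure_preimage_pos hO hN'o hN'O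
  rw [hinv s hs.measurableSet]
  calc 0 < P (r ⁻¹' W') * P (U ⁻¹' N') * μ V' :=
        ENNReal.mul_pos (ENNReal.mul_pos hWpos.ne' hNpos.ne').ne' (hv V' hV'o hvV').ne'
    _ = ∫⁻ x, V'.indicator (fun _ => P (r ⁻¹' W') * P (U ⁻¹' N')) x ∂μ :=
        (lintegral_indicator_const hV'o.measurableSet _).symm
    _ ≤ _ := by
      refine lintegral_mono fun x => ?_
      by_cases hx : x ∈ V'
      · rw [Set.indicator_of_mem hx,
          ← hrU.measure_inter_preimage_eq_mul _ _ hW'o.measurableSet hN'o.measurableSet]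
        refine measure_mono fun ω hω => ?_
        exact hVB (a := (x, r ω, U ω)) ⟨hV'V hx, hWN ⟨hW'W hω.1, hN'N hω.2⟩⟩
      · rw [Set.indicator_of_notMem hx]
        exact bot_le

/-- A ball of relative radius at most `lam` is covered by the cone over its boundary sphere. -/
lemma exists_norm_smul_sub_eq {E : Type*} [NormedAddCommGroup E] [NormedSpace ℝ E] {x z : E}
    {ρ : ℝ} (hz : z ≠ 0) (h : ‖z - x‖ ≤ ρ) : ∃ s : ℝ, 0 < s ∧ ‖s • z - x‖ = ρ := by
  have hρ : 0 ≤ ρ := (norm_nonneg _).trans h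
  have hz' := norm_pos_iff.2 hz
  set b := 1 + (ρ + ‖x‖) / ‖z‖ with hb
  have hb1 : 1 ≤ b := le_add_of_nonneg_right (by positivity)
  have hbig : ρ ≤ ‖b • z - x‖ := by
    have h1 := norm_sub_norm_le (b • z) x
    rw [norm_smul, Real.norm_of_nonneg (by linarith)] at h1
    have h2 : b * ‖z‖ = ‖z‖ + (ρ + ‖x‖) := by rw [hb]; field_simp
    linarith
  obtain ⟨s, hs, hsρ⟩ := intermediate_value_Icc hb1
    (f := fun s : ℝ => ‖s • z - x‖) (by fun_prop) ⟨by simpa using h, hbig⟩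
  exact ⟨s, by linarith [hs.1], hsρ⟩

theorem stmt3 {L : ℕ} (hL : 2 ≤ L) {Ω : Type*} [MeasurableSpace Ω]
    (P : Measure Ω) [IsProbabilityMeasure P]
    (lam : ℝ) (hlam : lam ∈ Set.Ioo (0:ℝ) 1)
    (r : Ω → ℝ) (hr : Measurable r) (hr01 : ∀ ω, r ω ∈ Set.Icc (0:ℝ) 1)
    (hr0 : P {ω | r ω = 0} < 1)
    (U : Ω → Matrix (Fin (L+1)) (Fin (L+1)) ℝ) (hU : IsHaarOrth P U)
    (hrU : IndepFun r U P)
    (κ : ℕ → ℝ) (hκpos : ∀ i, 1 ≤ i → i ≤ L+1 → 0 < κ i)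
    (hκmono : ∀ i j, 1 ≤ i → i ≤ j → j ≤ L+1 → κ j ≤ κ i)
    (R : Matrix (Fin (L+1)) (Fin (L+1)) ℝ)
    (hR : R = Matrix.diagonal fun k : Fin (L+1) => κ (L+1-(k:ℕ)))
    (hbig : ∀ i, 1 ≤ i → i ≤ L → (κ i - κ (i+1)) / κ (i+1) < lam)
    (hone : (1:ℝ) ∈ msupport (Measure.map r P))
    (μ : Measure (Sph L)) [IsProbabilityMeasure μ]
    (hinv : ∀ A : Set (Sph L), MeasurableSet A →
      μ A = ∫⁻ v, P {ω | actS (R * (1 + (lam * r ω) • U ω)) v ∈ A} ∂μ) :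
    msupport μ = (Set.univ : Set (Sph L)) := by
  have ha : ∀ k : Fin (L+1), 0 < κ (L+1-(k:ℕ)) := fun k => hκpos _ (by omega) (by omega)
  have hD : ∀ (x : EuclideanSpace ℝ (Fin (L+1))) i,
      Matrix.toEuclideanLin R x i = κ (L+1-(i:ℕ)) * x i := by
    intro x i
    rw [hR, Matrix.toLpLin_apply]
    exact Matrix.mulVec_diagonal (fun k : Fin (L+1) => κ (L+1-(k:ℕ))) x i
  have hDne : ∀ x : EuclideanSpace ℝ (Fin (L+1)), x ≠ 0 → Matrix.toEuclideanLin R x ≠ 0 := by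
    intro x hx h0
    refine hx (PiLp.ext fun i => ?_)
    have h1 := hD x i
    rw [h0] at h1
    simpa [(ha i).ne'] using h1.symm
  have hμne : (msupport μ).Nonempty := by
    obtain ⟨v, hv⟩ := Measure.nonempty_support (IsProbabilityMeasure.ne_zero μ)
    exact ⟨v, fun s hs hvs => (Measure.mem_support_iff_forall v).1 hv s (hs.mem_nhds hvs)⟩
  set K : Set (EuclideanSpace ℝ (Fin (L+1))) :=
    {x | ∃ v ∈ msupport μ, ∃ c : ℝ, 0 < c ∧ x = c • (v : EuclideanSpace ℝ (Fin (L+1)))}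
  have hnorm : ∀ v : Sph L, ‖(v : EuclideanSpace ℝ (Fin (L+1)))‖ = 1 := fun v =>
    mem_sphere_zero_iff_norm.1 v.2
  have hstep : ∀ x ∈ K, ∀ w, ‖w‖ ≤ lam * ‖x‖ → Matrix.toEuclideanLin R (x + w) ∈ K := by
    rintro _ ⟨v, hv, c, hc, rfl⟩ w hw
    rw [norm_smul, hnorm, mul_one, Real.norm_of_nonneg hc.le] at hw
    have hlamc : 0 < lam * c := mul_pos hlam.1 hc
    have hz : c • (v : EuclideanSpace ℝ (Fin (L+1))) + w ≠ 0 := by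
      intro h0
      rw [add_eq_zero_iff_neg_eq] at h0
      rw [← h0, norm_neg, norm_smul, hnorm, mul_one, Real.norm_of_nonneg hc.le] at hw
      nlinarith [hlam.2]
    obtain ⟨s, hs, hsz⟩ := exists_norm_smul_sub_eq (ρ := lam * c)
      (x := c • (v : EuclideanSpace ℝ (Fin (L+1)))) hz (by rwa [add_sub_cancel_left])
    set z := c • (v : EuclideanSpace ℝ (Fin (L+1))) + w
    obtain ⟨O, hO, hOv⟩ := exists_orthogonal_toEuclideanLin_eq
      (v := (v : EuclideanSpace ℝ (Fin (L+1))))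
      (w := (lam * c)⁻¹ • (s • z - c • (v : EuclideanSpace ℝ (Fin (L+1))))) (by
        rw [hnorm, norm_smul, hsz, Real.norm_of_nonneg (inv_nonneg.2 hlamc.le),
          inv_mul_cancel₀ hlamc.ne'])
    have hT : Matrix.toEuclideanLin (R * (1 + lam • O)) (v : EuclideanSpace ℝ (Fin (L+1))) =
        (s / c) • Matrix.toEuclideanLin R z := by
      have h1 : (v : EuclideanSpace ℝ (Fin (L+1))) +
          lam • Matrix.toEuclideanLin O (v : EuclideanSpace ℝ (Fin (L+1))) = (s / c) • z := by
        rw [hOv, smul_smul, smul_sub, smul_smul, smul_smul]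
        have e1 : lam * (lam * c)⁻¹ * s = s / c := by
          have := hlam.1.ne'; field_simp
        have e2 : lam * (lam * c)⁻¹ * c = 1 := by
          have := hlam.1.ne'; field_simp
        rw [e1, e2, one_smul, add_sub_cancel]
      rw [← map_smul, ← h1]
      simp [Matrix.toLpLin_apply, Matrix.mulVec_add]
    have hsc : 0 < s / c := div_pos hs hc
    have hne := smul_ne_zero hsc.ne' (hDne z hz)
    rw [← hT] at hne
    refine ⟨_, actS_mem_msupport hr hU hrU hone hinv hv hO hne,
      (s / c)⁻¹ * ‖Matrix.toEuclideanLin (R * (1 + lam • O)) (v : EuclideanSpace ℝ (Fin (L+1)))‖,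
      mul_pos (inv_pos.2 hsc) (norm_pos_iff.2 hne), ?_⟩
    rw [coe_actS hne, act, smul_smul, mul_assoc, mul_inv_cancel₀ (norm_ne_zero_iff.2 hne), mul_one,
      hT, smul_smul, inv_mul_cancel₀ hsc.ne', one_smul]
  refine Set.eq_univ_of_forall fun y => ?_
  have hyK : (y : EuclideanSpace ℝ (Fin (L+1))) ∈ K := by
    refine mem_of_diag_dynamics (by omega) hD hlam.1 ha ?_ ?_ ?_ ?_ ?_ hstep ?_
    · intro i j hij
      have : (i:ℕ) ≤ j := hij
      exact hκmono _ _ (by omega) (by omega) (by omega)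
    · intro i
      have h1 := hbig (L - i) (by omega) (by omega)
      have h2 := hκpos (L - i + 1) (by omega) (by omega)
      rw [div_lt_iff₀ h2] at h1
      have e1 : L + 1 - (i.succ : ℕ) = L - i := by simp
      have e2 : L + 1 - (i.castSucc : ℕ) = L - i + 1 := by simp; omega
      rw [e1, e2]
      linarith
    · rintro ⟨v, -, c, hc, h0⟩
      have h1 := congrArg norm h0
      rw [norm_zero, norm_smul, hnorm, mul_one, Real.norm_of_nonneg hc.le] at h1
      exact hc.ne h1
    · obtain ⟨v, hv⟩ := hμne
      exact ⟨v, v, hv, 1, one_pos, (one_smul ℝ _).symm⟩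
    · rintro c hc _ ⟨v, hv, d, hd, rfl⟩
      exact ⟨v, hv, c * d, mul_pos hc hd, smul_smul _ _ _⟩
    · exact norm_ne_zero_iff.1 (by rw [hnorm]; exact one_ne_zero)
  obtain ⟨v, hv, c, hc, hvc⟩ := hyK
  have h1 := congrArg norm hvc
  rw [norm_smul, hnorm, hnorm, mul_one, Real.norm_of_nonneg hc.le] at h1
  rw [← h1, one_smul] at hvc
  rwa [Subtype.ext hvc]
end
end
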